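/- arXiv:2403.17464 — 5 statements merged into one kernel-verified Lean document; each statement's English description precedes it below -/
import Mathlib

section
/- Let β > 0, γ ∈ ℝ and d ≥ 1. There exists a constant C < ∞ depending only on β and γ such that for all φ, ξ ∈ ℝ^d with (φ,ξ) ≠ (0,0) and every measurable function f : ℝ → [0,∞], one has ∫_ℝ W(t,φ,ξ)^{2γ} · (∫_{−∞}^t K(t,s,φ,ξ) · f(s) ds)² dt ≤ C · (∫_ℝ W(s,φ,ξ)^{γ−β} · f(s) ds)². -/
open MeasureTheory Real
open scoped ENNReal

/-- The weight `W(t,φ,ξ) = max(‖ξ - tφ‖, ‖φ‖^{1/(1+2β)})`. -/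
noncomputable def Wgt (β : ℝ) {d : ℕ} (t : ℝ) (φ ξ : EuclideanSpace ℝ (Fin d)) : ℝ :=
  max ‖ξ - t • φ‖ (‖φ‖ ^ (1 / (1 + 2 * β)))

/-- The Kolmogorov kernel `K(t,s,φ,ξ) = exp(-∫_s^t ‖ξ - τφ‖^{2β} dτ)`. -/
noncomputable def Kker (β : ℝ) {d : ℕ} (t s : ℝ) (φ ξ : EuclideanSpace ℝ (Fin d)) : ℝ :=
  Real.exp (-(∫ τ in s..t, ‖ξ - τ • φ‖ ^ (2 * β)))

/-- Cauchy–Schwarz with respect to the measure of density `g`. -/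
lemma lintegral_mul_sq_le {α : Type*} [MeasurableSpace α] {μ : Measure α} {k g : α → ℝ≥0∞}
    (hk : Measurable k) (hg : Measurable g) :
    (∫⁻ a, k a * g a ∂μ) ^ 2 ≤ (∫⁻ a, k a ^ 2 * g a ∂μ) * ∫⁻ a, g a ∂μ := by
  have h := ENNReal.lintegral_mul_le_Lp_mul_Lq (μ.withDensity g) Real.HolderConjugate.two_two
    (f := k) (g := fun _ => 1) hk.aemeasurable measurable_const.aemeasurable
  have e1 : ∫⁻ a, (k * fun _ => (1 : ℝ≥0∞) : α → ℝ≥0∞) a ∂(μ.withDensity g) = ∫⁻ a, k a * g a ∂μ := by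
    rw [lintegral_withDensity_eq_lintegral_mul _ hg (by fun_prop)]
    simp [mul_comm]
  have e2 : ∫⁻ a, k a ^ (2 : ℝ) ∂(μ.withDensity g) = ∫⁻ a, k a ^ 2 * g a ∂μ := by
    rw [lintegral_withDensity_eq_lintegral_mul _ hg (by fun_prop)]
    simp [mul_comm]
  have e3 : ∫⁻ _, (1 : ℝ≥0∞) ^ (2 : ℝ) ∂(μ.withDensity g) = ∫⁻ a, g a ∂μ := by
    simp
  rw [e1, e2, e3] at h
  calc _ ≤ _ := pow_le_pow_left₀ zero_le h 2
    _ = _ := by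
      rw [mul_pow, ← ENNReal.rpow_natCast, ← ENNReal.rpow_mul, ← ENNReal.rpow_natCast,
        ← ENNReal.rpow_mul]
      norm_num

/-- An integral operator whose kernel has uniformly bounded columns in `L²` is bounded from `L¹`
to `L²`. -/
lemma lintegral_sq_lintegral_le {α : Type*} [MeasurableSpace α] {μ : Measure α} [SFinite μ]
    {k : α → α → ℝ≥0∞} (hk : Measurable (Function.uncurry k)) {g : α → ℝ≥0∞} (hg : Measurable g)
    {C : ℝ≥0∞} (h : ∀ s, ∫⁻ t, k t s ^ 2 ∂μ ≤ C) :
    ∫⁻ t, (∫⁻ s, k t s * g s ∂μ) ^ 2 ∂μ ≤ C * (∫⁻ s, g s ∂μ) ^ 2 := by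
  have hm : Measurable (Function.uncurry fun t s => k t s ^ 2 * g s) :=
    (hk.pow_const 2).mul (hg.comp measurable_snd)
  calc
    _ ≤ ∫⁻ t, (∫⁻ s, k t s ^ 2 * g s ∂μ) * ∫⁻ s, g s ∂μ ∂μ :=
      lintegral_mono fun t => lintegral_mul_sq_le (hk.comp measurable_prodMk_left) hg
    _ = (∫⁻ s, ∫⁻ t, k t s ^ 2 * g s ∂μ ∂μ) * ∫⁻ s, g s ∂μ := by
      rw [lintegral_mul_const _ (Measurable.lintegral_prod_right hm), lintegral_lintegral_swap hm.aemeasurable]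
    _ ≤ (∫⁻ s, C * g s ∂μ) * ∫⁻ s, g s ∂μ := by
      gcongr with s
      have hks : Measurable fun t => k t s ^ 2 :=
        (hk.comp measurable_prodMk_right : Measurable fun t => k t s).pow_const 2
      rw [lintegral_mul_const _ hks]
      gcongr
      exact h s
    _ = _ := by rw [lintegral_const_mul _ hg, sq, mul_assoc]

lemma rpow_le_abs_rpow_mul {x y M p : ℝ} (hx : 0 < x) (hy : 0 < y) (hM : 0 < M)
    (hxy : x ≤ M * y) (hyx : y ≤ M * x) : x ^ p ≤ M ^ |p| * y ^ p := by
  rcases le_total 0 p with hp | hp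
  · rw [abs_of_nonneg hp, ← mul_rpow hM.le hy.le]
    exact rpow_le_rpow hx.le hxy hp
  · have h : (M * x) ^ p ≤ y ^ p := rpow_le_rpow_of_nonpos hy hyx hp
    rw [mul_rpow hM.le hx.le] at h
    calc x ^ p = M ^ |p| * (M ^ p * x ^ p) := by
          rw [abs_of_nonpos hp, ← mul_assoc, ← rpow_add hM, neg_add_cancel, rpow_zero, one_mul]
      _ ≤ _ := by gcongr

lemma one_add_rpow_le_mul_exp {u r : ℝ} (hu : 0 ≤ u) (hr : 0 ≤ r) :
    (1 + u) ^ r ≤ (r + 1) ^ r * exp (1 + u) := by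
  have h1 : 1 + u ≤ (r + 1) * exp ((1 + u) / (r + 1)) := by
    have := add_one_le_exp ((1 + u) / (r + 1))
    rw [← div_le_iff₀' (by positivity)]
    linarith
  calc (1 + u) ^ r ≤ ((r + 1) * exp ((1 + u) / (r + 1))) ^ r := by gcongr
    _ = (r + 1) ^ r * exp ((1 + u) / (r + 1) * r) := by
      rw [mul_rpow (by positivity) (exp_pos _).le, ← exp_mul]
    _ ≤ _ := by
      gcongr
      rw [div_mul_eq_mul_div, div_le_iff₀ (by positivity)]
      nlinarith

lemma lintegral_Ioi_exp_neg_integral_le_one {v : ℝ → ℝ} (hv : Continuous v) (h0 : ∀ t, 0 ≤ v t)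
    (s : ℝ) : ∫⁻ t in Set.Ioi s, ENNReal.ofReal (exp (-∫ τ in s..t, v τ) * v t) ≤ 1 := by
  set F : ℝ → ℝ := fun t => -exp (-∫ τ in s..t, v τ) with hF
  have hd : ∀ t, HasDerivAt F (exp (-∫ τ in s..t, v τ) * v t) t := fun t => by
    have := (hv.integral_hasStrictDerivAt s t).hasDerivAt.fun_neg.exp.fun_neg
    simpa using this
  have hpos : ∀ t, 0 ≤ exp (-∫ τ in s..t, v τ) * v t := fun t => mul_nonneg (exp_pos _).le (h0 t)
  have hmono : Monotone F := monotone_of_hasDerivAt_nonneg hd hpos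
  have hbdd : BddAbove (Set.range F) :=
    ⟨0, by rintro _ ⟨t, rfl⟩; exact neg_nonpos.2 (exp_pos _).le⟩
  have hl := tendsto_atTop_ciSup hmono hbdd
  have hc : ContinuousWithinAt F (Set.Ici s) s := (hd s).continuousAt.continuousWithinAt
  have hi := integrableOn_Ioi_deriv_of_nonneg hc (fun t _ => hd t) (fun t _ => hpos t) hl
  rw [← ofReal_integral_eq_lintegral_ofReal hi (Filter.Eventually.of_forall hpos),
    integral_Ioi_of_hasDerivAt_of_tendsto hc (fun t _ => hd t) hi hl]
  have hs : F s = -1 := by simp [hF]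
  have : ⨆ t, F t ≤ 0 := ciSup_le fun t => neg_nonpos.2 (exp_pos _).le
  rw [hs]
  exact ENNReal.ofReal_le_one.2 (by linarith)

section Weight

variable {β : ℝ} {d : ℕ} {φ ξ : EuclideanSpace ℝ (Fin d)}

lemma continuous_Wgt : Continuous fun t => Wgt β t φ ξ := by
  unfold Wgt
  fun_prop

lemma continuous_Wgt_rpow (hβ : 0 < β) : Continuous fun t => Wgt β t φ ξ ^ (2 * β) :=
  continuous_Wgt.rpow_const fun _ => Or.inr (by positivity)

lemma continuous_norm_rpow (hβ : 0 < β) : Continuous fun t : ℝ => ‖ξ - t • φ‖ ^ (2 * β) :=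
  Continuous.rpow_const (by fun_prop) fun _ => Or.inr (by positivity)

lemma Wgt_pos (h : (φ, ξ) ≠ (0, 0)) (t : ℝ) : 0 < Wgt β t φ ξ := by
  unfold Wgt
  by_cases hφ : φ = 0
  · subst hφ
    have : ξ ≠ 0 := fun h' => h (by rw [h'])
    exact lt_max_of_lt_left (by simpa)
  · exact lt_max_of_lt_right (by positivity)

lemma Wgt_sub_le (s t : ℝ) : Wgt β t φ ξ - Wgt β s φ ξ ≤ ‖φ‖ * |t - s| := by
  have h : ‖ξ - t • φ‖ ≤ ‖ξ - s • φ‖ + ‖φ‖ * |t - s| := by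
    have : ξ - t • φ = (ξ - s • φ) + (s - t) • φ := by rw [sub_smul]; abel
    rw [this]
    refine (norm_add_le _ _).trans_eq ?_
    rw [norm_smul, Real.norm_eq_abs, abs_sub_comm, mul_comm ‖φ‖]
  have h0 : 0 ≤ ‖φ‖ * |t - s| := by positivity
  rw [sub_le_iff_le_add']
  unfold Wgt
  refine max_le (h.trans ?_) ?_
  · gcongr; exact le_max_left _ _
  · linarith [le_max_right ‖ξ - s • φ‖ (‖φ‖ ^ (1 / (1 + 2 * β)))]

lemma norm_eq_rpow (hβ : 0 < β) (φ : EuclideanSpace ℝ (Fin d)) :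
    ‖φ‖ = (‖φ‖ ^ (1 / (1 + 2 * β))) ^ (1 + 2 * β) := by
  rw [← rpow_mul (norm_nonneg _), one_div_mul_cancel (by positivity), rpow_one]

/-- If `W` exceeds `M` on an interval of length `M / ‖φ‖`, then `M ≤ B ∫ W^{2β}` for every value
`B ≤ M` above the floor of `W`. -/
lemma le_mul_integral_Wgt (hβ : 0 < β) (hφ : φ ≠ 0) {s t c e M B : ℝ} (hsc : s ≤ c)
    (het : e ≤ t) (hce : e - c = M / ‖φ‖) (hB : ‖φ‖ ^ (1 / (1 + 2 * β)) ≤ B) (hBM : B ≤ M)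
    (hM : ∀ τ ∈ Set.Icc c e, M ≤ Wgt β τ φ ξ) :
    M ≤ B * ∫ τ in s..t, Wgt β τ φ ξ ^ (2 * β) := by
  have hm : 0 < ‖φ‖ ^ (1 / (1 + 2 * β)) := by positivity
  have hB0 : 0 < B := hm.trans_le hB
  have hM0 : 0 < M := hB0.trans_le hBM
  have hφ0 : 0 < ‖φ‖ := norm_pos_iff.2 hφ
  have hce' : c ≤ e := by
    have : 0 < M / ‖φ‖ := by positivity
    linarith
  have hW : Continuous fun t => Wgt β t φ ξ ^ (2 * β) := continuous_Wgt_rpow hβ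
  have h1 : ∫ τ in c..e, Wgt β τ φ ξ ^ (2 * β) ≤ ∫ τ in s..t, Wgt β τ φ ξ ^ (2 * β) := by
    apply intervalIntegral.integral_mono_interval hsc hce' het _ (hW.intervalIntegrable _ _)
    exact Filter.Eventually.of_forall fun τ =>
      rpow_nonneg (le_max_of_le_left (norm_nonneg _)) _
  have h2 : (e - c) * M ^ (2 * β) ≤ ∫ τ in c..e, Wgt β τ φ ξ ^ (2 * β) := by
    rw [← smul_eq_mul, ← intervalIntegral.integral_const]
    refine intervalIntegral.integral_mono_on hce' (by simp) (hW.intervalIntegrable _ _) ?_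
    intro τ hτ
    exact rpow_le_rpow hM0.le (hM τ hτ) (by positivity)
  have h3 : M / B ≤ (e - c) * M ^ (2 * β) := by
    calc M / B ≤ (M / B) ^ (1 + 2 * β) :=
          self_le_rpow_of_one_le ((one_le_div hB0).2 hBM) (by linarith)
      _ = M ^ (1 + 2 * β) / B ^ (1 + 2 * β) := div_rpow hM0.le hB0.le _
      _ ≤ M ^ (1 + 2 * β) / ‖φ‖ := by
          gcongr
          calc ‖φ‖ = _ := norm_eq_rpow hβ φ
            _ ≤ _ := by gcongr
      _ = _ := by rw [hce, rpow_add hM0, rpow_one]; ring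
  rw [← div_le_iff₀' hB0]
  linarith

lemma integral_Wgt_nonneg {s t : ℝ} (hst : s ≤ t) :
    0 ≤ ∫ τ in s..t, Wgt β τ φ ξ ^ (2 * β) :=
  intervalIntegral.integral_nonneg hst fun _ _ =>
    rpow_nonneg (le_max_of_le_left (norm_nonneg _)) _

lemma Wgt_growth (hβ : 0 < β) (h : (φ, ξ) ≠ (0, 0)) {s t : ℝ} (hst : s ≤ t) :
    Wgt β t φ ξ ≤ 2 * (1 + ∫ τ in s..t, Wgt β τ φ ξ ^ (2 * β)) * Wgt β s φ ξ ∧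
    Wgt β s φ ξ ≤ 2 * (1 + ∫ τ in s..t, Wgt β τ φ ξ ^ (2 * β)) * Wgt β t φ ξ := by
  have hu := integral_Wgt_nonneg (β := β) (φ := φ) (ξ := ξ) hst
  have hs : 0 < Wgt β s φ ξ := Wgt_pos h s
  have ht : 0 < Wgt β t φ ξ := Wgt_pos h t
  have l1 := Wgt_sub_le (β := β) (φ := φ) (ξ := ξ) s t
  have l2 := Wgt_sub_le (β := β) (φ := φ) (ξ := ξ) t s
  rw [abs_of_nonneg (by linarith)] at l1
  rw [abs_of_nonpos (by linarith)] at l2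
  by_cases hφ : φ = 0
  · have h0 : ‖φ‖ = 0 := by simp [hφ]
    rw [h0] at l1 l2
    constructor <;> nlinarith
  have hφ0 : 0 < ‖φ‖ := norm_pos_iff.2 hφ
  constructor
  · by_cases hc : Wgt β t φ ξ ≤ 2 * Wgt β s φ ξ
    · nlinarith
    push Not at hc
    have := le_mul_integral_Wgt (ξ := ξ) hβ hφ (s := s) (t := t)
      (c := t - Wgt β t φ ξ / 2 / ‖φ‖) (e := t)
      (M := Wgt β t φ ξ / 2) (B := Wgt β s φ ξ) ?_ le_rfl (by ring) (le_max_right _ _)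
      (by linarith) ?_
    · nlinarith
    · have : Wgt β t φ ξ / 2 / ‖φ‖ ≤ t - s := by rw [div_le_iff₀ hφ0]; linarith
      linarith
    · rintro τ ⟨h1, h2⟩
      have l := Wgt_sub_le (β := β) (φ := φ) (ξ := ξ) τ t
      rw [abs_of_nonneg (by linarith)] at l
      have : t - τ ≤ Wgt β t φ ξ / 2 / ‖φ‖ := by linarith
      rw [le_div_iff₀ hφ0] at this
      linarith
  · by_cases hc : Wgt β s φ ξ ≤ 2 * Wgt β t φ ξ
    · nlinarith
    push Not at hc
    have := le_mul_integral_Wgt (ξ := ξ) hβ hφ (s := s) (t := t)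
      (c := s) (e := s + Wgt β s φ ξ / 2 / ‖φ‖)
      (M := Wgt β s φ ξ / 2) (B := Wgt β t φ ξ) le_rfl ?_ (by ring) (le_max_right _ _)
      (by linarith) ?_
    · nlinarith
    · have : Wgt β s φ ξ / 2 / ‖φ‖ ≤ t - s := by rw [div_le_iff₀ hφ0]; linarith
      linarith
    · rintro τ ⟨h1, h2⟩
      have l := Wgt_sub_le (β := β) (φ := φ) (ξ := ξ) τ s
      rw [abs_of_nonpos (by linarith)] at l
      have : τ - s ≤ Wgt β s φ ξ / 2 / ‖φ‖ := by linarith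
      rw [le_div_iff₀ hφ0] at this
      linarith

/-- Replacing `‖ξ - τφ‖` by `W` costs a bounded amount, since the two differ only on an interval
of length at most of order `‖φ‖^{-2β/(1+2β)}`. -/
lemma integral_Wgt_le (hβ : 0 < β) {s t : ℝ} (hst : s ≤ t) :
    ∫ τ in s..t, Wgt β τ φ ξ ^ (2 * β) ≤ (∫ τ in s..t, ‖ξ - τ • φ‖ ^ (2 * β)) + 4 := by
  set m := ‖φ‖ ^ (1 / (1 + 2 * β)) with hm
  have hm0 : 0 ≤ m := by positivity
  by_cases hS : ∃ τ₀ : ℝ, ‖ξ - τ₀ • φ‖ < m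
  swap
  · push Not at hS
    have : ∀ τ : ℝ, Wgt β τ φ ξ = ‖ξ - τ • φ‖ := fun τ => max_eq_left (hS τ)
    simp only [this]
    linarith
  obtain ⟨τ₀, h0⟩ := hS
  have hmpos : 0 < m := (norm_nonneg _).trans_lt h0
  have hφ0 : 0 < ‖φ‖ := by
    rw [norm_eq_rpow hβ φ, ← hm]
    positivity
  set S := Set.Icc (τ₀ - 2 * m / ‖φ‖) (τ₀ + 2 * m / ‖φ‖)
  have hpt : ∀ τ : ℝ, Wgt β τ φ ξ ^ (2 * β) ≤
      ‖ξ - τ • φ‖ ^ (2 * β) + S.indicator (fun _ => m ^ (2 * β)) τ := by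
    intro τ
    have hind : 0 ≤ S.indicator (fun _ => m ^ (2 * β)) τ :=
      Set.indicator_nonneg (fun _ _ => by positivity) τ
    rcases le_or_gt m ‖ξ - τ • φ‖ with h | h
    · rw [Wgt, max_eq_left h]
      linarith
    · have hτ : τ ∈ S := by
        have h1 : ‖(τ - τ₀) • φ‖ ≤ 2 * m := by
          have : (τ - τ₀) • φ = (ξ - τ₀ • φ) - (ξ - τ • φ) := by rw [sub_smul]; abel
          rw [this]
          linarith [norm_sub_le (ξ - τ₀ • φ) (ξ - τ • φ)]
        rw [norm_smul, Real.norm_eq_abs, ← le_div_iff₀ hφ0, abs_le] at h1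
        constructor <;> linarith
      rw [Wgt, max_eq_right h.le, Set.indicator_of_mem hτ]
      have : 0 ≤ ‖ξ - τ • φ‖ ^ (2 * β) := by positivity
      linarith
  have hint : Integrable (S.indicator fun _ => m ^ (2 * β)) :=
    (integrable_indicator_iff measurableSet_Icc).2 (by simp)
  have hn : Continuous fun t : ℝ => ‖ξ - t • φ‖ ^ (2 * β) := continuous_norm_rpow hβ
  calc _ ≤ ∫ τ in s..t, (‖ξ - τ • φ‖ ^ (2 * β) + S.indicator (fun _ => m ^ (2 * β)) τ) :=
        intervalIntegral.integral_mono_on hst ((continuous_Wgt_rpow hβ).intervalIntegrable _ _)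
          ((hn.intervalIntegrable _ _).add hint.intervalIntegrable) fun τ _ => hpt τ
    _ = (∫ τ in s..t, ‖ξ - τ • φ‖ ^ (2 * β)) +
          ∫ τ in s..t, S.indicator (fun _ => m ^ (2 * β)) τ :=
        intervalIntegral.integral_add (hn.intervalIntegrable _ _) hint.intervalIntegrable
    _ ≤ _ := by
        gcongr
        rw [intervalIntegral.integral_of_le hst]
        calc _ ≤ ∫ τ, S.indicator (fun _ => m ^ (2 * β)) τ :=
              setIntegral_le_integral hint (Filter.Eventually.of_forall fun τ =>
                Set.indicator_nonneg (fun _ _ => by positivity) τ)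
          _ = 4 * (m * m ^ (2 * β)) / ‖φ‖ := by
              rw [integral_indicator measurableSet_Icc, setIntegral_const, measureReal_def,
                Real.volume_Icc, ENNReal.toReal_ofReal (by
                  have : 0 < 2 * m / ‖φ‖ := by positivity
                  linarith), smul_eq_mul]
              ring
          _ = 4 := by
              have : m * m ^ (2 * β) = ‖φ‖ := by
                conv_rhs => rw [norm_eq_rpow hβ φ, ← hm, rpow_add hmpos, rpow_one]
              rw [this, mul_div_assoc, div_self hφ0.ne', mul_one]
          _ ≤ 4 := le_rfl

lemma Kker_nonneg (s t : ℝ) : 0 ≤ Kker β t s φ ξ := (exp_pos _).le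

lemma continuous_Kker (hβ : 0 < β) : Continuous fun p : ℝ × ℝ => Kker β p.1 p.2 φ ξ := by
  have hn : Continuous fun t : ℝ => ‖ξ - t • φ‖ ^ (2 * β) := continuous_norm_rpow hβ
  have hF : Continuous fun t : ℝ => ∫ τ in (0 : ℝ)..t, ‖ξ - τ • φ‖ ^ (2 * β) :=
    intervalIntegral.continuous_primitive (fun _ _ => hn.intervalIntegrable _ _) 0
  have : (fun p : ℝ × ℝ => Kker β p.1 p.2 φ ξ) = fun p : ℝ × ℝ =>
      exp (-((∫ τ in (0 : ℝ)..p.1, ‖ξ - τ • φ‖ ^ (2 * β)) -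
        ∫ τ in (0 : ℝ)..p.2, ‖ξ - τ • φ‖ ^ (2 * β))) := by
    ext p
    rw [intervalIntegral.integral_interval_sub_left (hn.intervalIntegrable _ _)
      (hn.intervalIntegrable _ _), Kker]
  rw [this]
  fun_prop

/-- The constant in the column estimate for the Kolmogorov kernel. -/
noncomputable def columnConst (β γ : ℝ) : ℝ :=
  2 ^ |2 * γ - 2 * β| * (|2 * γ - 2 * β| + 1) ^ |2 * γ - 2 * β| * exp 9

lemma Wgt_mul_Kker_sq_le {γ : ℝ} (hβ : 0 < β) (h : (φ, ξ) ≠ (0, 0)) {s t : ℝ} (hst : s ≤ t) :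
    (Wgt β t φ ξ ^ γ * Kker β t s φ ξ * Wgt β s φ ξ ^ (β - γ)) ^ 2 ≤ columnConst β γ *
      (exp (-∫ τ in s..t, Wgt β τ φ ξ ^ (2 * β)) * Wgt β t φ ξ ^ (2 * β)) := by
  have hu := integral_Wgt_nonneg (β := β) (φ := φ) (ξ := ξ) hst
  have hs : 0 < Wgt β s φ ξ := Wgt_pos h s
  have ht : 0 < Wgt β t φ ξ := Wgt_pos h t
  obtain ⟨g1, g2⟩ := Wgt_growth hβ h hst
  have hK : Kker β t s φ ξ ≤ exp (4 - ∫ τ in s..t, Wgt β τ φ ξ ^ (2 * β)) := by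
    have := integral_Wgt_le (φ := φ) (ξ := ξ) hβ hst
    exact exp_le_exp.2 (by linarith)
  set u := ∫ τ in s..t, Wgt β τ φ ξ ^ (2 * β) with hudef
  set p := 2 * γ - 2 * β with hp
  have hW := rpow_le_abs_rpow_mul (p := p) ht hs (by positivity) g1 g2
  rw [mul_rpow (by norm_num) (by positivity)] at hW
  have hE := one_add_rpow_le_mul_exp hu (abs_nonneg p)
  have e1 : (Wgt β t φ ξ ^ γ) ^ 2 = Wgt β t φ ξ ^ (2 * β) * Wgt β t φ ξ ^ p := by
    rw [← rpow_add ht, ← rpow_natCast, ← rpow_mul ht.le, hp]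
    congr 1; push_cast; ring
  have e2 : Wgt β s φ ξ ^ p * (Wgt β s φ ξ ^ (β - γ)) ^ 2 = 1 := by
    rw [← rpow_natCast, ← rpow_mul hs.le, ← rpow_add hs, hp, ← rpow_zero (Wgt β s φ ξ)]
    congr 1; push_cast; ring
  have hK0 : 0 ≤ Kker β t s φ ξ := Kker_nonneg s t
  calc _ = Wgt β t φ ξ ^ (2 * β) * Wgt β t φ ξ ^ p * Kker β t s φ ξ ^ 2 *
          (Wgt β s φ ξ ^ (β - γ)) ^ 2 := by rw [mul_pow, mul_pow, e1]
    _ ≤ Wgt β t φ ξ ^ (2 * β) *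
          (2 ^ |p| * ((|p| + 1) ^ |p| * exp (1 + u)) * Wgt β s φ ξ ^ p) * exp (4 - u) ^ 2 *
          (Wgt β s φ ξ ^ (β - γ)) ^ 2 := by
        gcongr
        exact hW.trans (by gcongr)
    _ = 2 ^ |p| * (|p| + 1) ^ |p| * (exp (1 + u) * exp (4 - u) ^ 2) * Wgt β t φ ξ ^ (2 * β) *
          (Wgt β s φ ξ ^ p * (Wgt β s φ ξ ^ (β - γ)) ^ 2) := by ring
    _ = 2 ^ |p| * (|p| + 1) ^ |p| * (exp 9 * exp (-u)) * Wgt β t φ ξ ^ (2 * β) := by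
        rw [e2, mul_one, ← exp_nat_mul, ← exp_add, ← exp_add]
        congr 3; push_cast; ring
    _ = _ := by rw [columnConst]; ring

lemma lintegral_Ici_Wgt_mul_Kker_sq_le (γ : ℝ) (hβ : 0 < β) (h : (φ, ξ) ≠ (0, 0)) (s : ℝ) :
    ∫⁻ t in Set.Ici s,
      ENNReal.ofReal (Wgt β t φ ξ ^ γ * Kker β t s φ ξ * Wgt β s φ ξ ^ (β - γ)) ^ 2 ≤
      ENNReal.ofReal (columnConst β γ) := by
  have hC : 0 ≤ columnConst β γ := by unfold columnConst; positivity
  have hpos : ∀ t, 0 < Wgt β t φ ξ := Wgt_pos h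
  calc _ ≤ ∫⁻ t in Set.Ici s, ENNReal.ofReal (columnConst β γ) * ENNReal.ofReal
          (exp (-∫ τ in s..t, Wgt β τ φ ξ ^ (2 * β)) * Wgt β t φ ξ ^ (2 * β)) := by
        refine setLIntegral_mono' measurableSet_Ici fun t ht => ?_
        rw [← ENNReal.ofReal_mul hC, ← ENNReal.ofReal_pow (mul_nonneg (mul_nonneg
          (rpow_nonneg (hpos t).le _) (Kker_nonneg s t)) (rpow_nonneg (hpos s).le _))]
        exact ENNReal.ofReal_le_ofReal (Wgt_mul_Kker_sq_le hβ h ht)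
    _ = ENNReal.ofReal (columnConst β γ) * ∫⁻ t in Set.Ioi s, ENNReal.ofReal
          (exp (-∫ τ in s..t, Wgt β τ φ ξ ^ (2 * β)) * Wgt β t φ ξ ^ (2 * β)) := by
        rw [lintegral_const_mul' _ _ ENNReal.ofReal_ne_top,
          setLIntegral_congr Ioi_ae_eq_Ici.symm]
    _ ≤ ENNReal.ofReal (columnConst β γ) * 1 := by
        gcongr
        exact lintegral_Ioi_exp_neg_integral_le_one (continuous_Wgt_rpow hβ)
          (fun t => rpow_nonneg (hpos t).le _) s
    _ = _ := mul_one _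

end Weight

/-- Proposition 2.16, second item: `T : L¹(W^{γ-β}) → L²(W^{2γ})` is bounded, with a
constant depending only on `β` and `γ`. -/
theorem duhamel_L1_to_L2 (β γ : ℝ) (hβ : 0 < β) :
    ∃ C : ℝ≥0∞, C ≠ ⊤ ∧
      ∀ (d : ℕ), 1 ≤ d → ∀ φ ξ : EuclideanSpace ℝ (Fin d), (φ, ξ) ≠ (0, 0) →
        ∀ f : ℝ → ℝ≥0∞, Measurable f →
          (∫⁻ t : ℝ, ENNReal.ofReal (Wgt β t φ ξ ^ (2 * γ)) *
              (∫⁻ s in Set.Iic t, ENNReal.ofReal (Kker β t s φ ξ) * f s) ^ 2)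
            ≤ C * (∫⁻ s : ℝ, ENNReal.ofReal (Wgt β s φ ξ ^ (γ - β)) * f s) ^ 2 := by
  refine ⟨ENNReal.ofReal (columnConst β γ), ENNReal.ofReal_ne_top, ?_⟩
  intro d _ φ ξ h f hf
  have hpos : ∀ t, 0 < Wgt β t φ ξ := Wgt_pos h
  have hWc : ∀ p : ℝ, Continuous fun t => Wgt β t φ ξ ^ p := fun p =>
    continuous_Wgt.rpow_const fun t => Or.inl (hpos t).ne'
  set k : ℝ → ℝ → ℝ≥0∞ := fun t s => ({p : ℝ × ℝ | p.2 ≤ p.1}).indicator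
    (fun p => ENNReal.ofReal
      (Wgt β p.1 φ ξ ^ γ * Kker β p.1 p.2 φ ξ * Wgt β p.2 φ ξ ^ (β - γ))) (t, s) with hk
  have hkm : Measurable (Function.uncurry k) := by
    refine Measurable.indicator ?_ (measurableSet_le measurable_snd measurable_fst)
    exact (((((hWc γ).comp continuous_fst).mul (continuous_Kker hβ)).mul
      ((hWc (β - γ)).comp continuous_snd)).measurable).ennreal_ofReal
  have hcol : ∀ s, ∫⁻ t, k t s ^ 2 ≤ ENNReal.ofReal (columnConst β γ) := by
    intro s
    refine le_of_eq_of_le ?_ (lintegral_Ici_Wgt_mul_Kker_sq_le γ hβ h s)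
    rw [← lintegral_indicator measurableSet_Ici]
    refine lintegral_congr fun t => ?_
    by_cases hst : s ≤ t <;> simp [hk, Set.indicator, hst]
  have hg : Measurable fun s => ENNReal.ofReal (Wgt β s φ ξ ^ (γ - β)) * f s :=
    (hWc _).measurable.ennreal_ofReal.mul hf
  refine le_of_eq_of_le ?_ (lintegral_sq_lintegral_le hkm hg hcol)
  refine lintegral_congr fun t => ?_
  have e : ENNReal.ofReal (Wgt β t φ ξ ^ (2 * γ)) = ENNReal.ofReal (Wgt β t φ ξ ^ γ) ^ 2 := by
    rw [← ENNReal.ofReal_pow (rpow_nonneg (hpos t).le _), ← rpow_natCast, ← rpow_mul (hpos t).le]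
    congr 2; push_cast; ring
  rw [e, ← mul_pow, ← lintegral_const_mul' _ _ ENNReal.ofReal_ne_top,
    ← lintegral_indicator measurableSet_Iic]
  congr 1
  refine lintegral_congr fun s => ?_
  by_cases hst : s ≤ t
  · have e2 : ENNReal.ofReal (Wgt β s φ ξ ^ (β - γ)) * ENNReal.ofReal (Wgt β s φ ξ ^ (γ - β))
        = 1 := by
      rw [← ENNReal.ofReal_mul (rpow_nonneg (hpos s).le _), ← rpow_add (hpos s)]
      simp
    simp only [hk, Set.indicator, Set.mem_Iic, Set.mem_ofPred_eq, hst, if_true]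
    rw [ENNReal.ofReal_mul (mul_nonneg (rpow_nonneg (hpos t).le _) (Kker_nonneg s t)),
      ENNReal.ofReal_mul (rpow_nonneg (hpos t).le _), mul_assoc _ _ (_ * f s),
      ← mul_assoc (ENNReal.ofReal (Wgt β s φ ξ ^ (β - γ))), e2, one_mul, mul_assoc]
  · simp [hk, Set.indicator, hst]
end

section
/- Let β > 0, γ ∈ ℝ and d ≥ 1. There exists a constant C < ∞ depending only on β, γ and d such that for every measurable function h : ℝ × ℝ^d × ℝ^d → [0,∞], defining (Th)(t,φ,ξ) = ∫_{−∞}^t K(t,s,φ,ξ)·h(s,φ,ξ) ds, one has for every t ∈ ℝ: (∫_{ℝ^d} ∫_{ℝ^d} W(t,φ,ξ)^{2γ−2β} · (Th)(t,φ,ξ)² dξ dφ)^{1/2} ≤ C · ∫_ℝ (∫_{ℝ^d} ∫_{ℝ^d} W(s,φ,ξ)^{2γ−2β} · h(s,φ,ξ)² dξ dφ)^{1/2} ds. -/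
open MeasureTheory Real
open scoped ENNReal

/-- Minkowski's integral inequality in `L²`. -/
theorem lintegral_sq_lintegral_rpow_half_le {X S : Type*} [MeasurableSpace X] [MeasurableSpace S]
    (μ : Measure X) (ν : Measure S) [SFinite μ] [SFinite ν] {G : S → X → ℝ≥0∞}
    (hG : Measurable (Function.uncurry G)) :
    (∫⁻ x, (∫⁻ s, G s x ∂ν) ^ 2 ∂μ) ^ ((1 : ℝ) / 2)
      ≤ ∫⁻ s, (∫⁻ x, G s x ^ 2 ∂μ) ^ ((1 : ℝ) / 2) ∂ν := by
  set N : S → ℝ≥0∞ := fun s => (∫⁻ x, G s x ^ 2 ∂μ) ^ ((1 : ℝ) / 2) with hN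
  have hGs : ∀ s, Measurable (G s) := fun s => hG.comp measurable_prodMk_left
  have hGx : ∀ x, Measurable (fun s => G s x) := fun x => hG.comp measurable_prodMk_right
  have hNm : Measurable N :=
    (hG.pow_const 2).lintegral_prod_right'.pow_const _
  have cauchy_schwarz : ∀ s s', ∫⁻ x, G s x * G s' x ∂μ ≤ N s * N s' := by
    intro s s'
    have := ENNReal.lintegral_mul_le_Lp_mul_Lq μ Real.HolderConjugate.two_two
      (hGs s).aemeasurable (hGs s').aemeasurable
    simpa [hN] using this
  have inner_swap : ∀ s, ∫⁻ x, G s x * ∫⁻ s', G s' x ∂ν ∂μ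
      = ∫⁻ s', ∫⁻ x, G s x * G s' x ∂μ ∂ν := by
    intro s
    simp_rw [← lintegral_const_mul _ (hGx _)]
    refine lintegral_lintegral_swap (Measurable.aemeasurable ?_)
    exact ((hGs s).comp measurable_fst).mul (hG.comp measurable_swap)
  have hI : Measurable fun x => ∫⁻ s', G s' x ∂ν := hG.lintegral_prod_left
  have key : ∫⁻ x, (∫⁻ s, G s x ∂ν) ^ 2 ∂μ ≤ (∫⁻ s, N s ∂ν) ^ 2 := by
    calc ∫⁻ x, (∫⁻ s, G s x ∂ν) ^ 2 ∂μ
        = ∫⁻ x, ∫⁻ s, G s x * ∫⁻ s', G s' x ∂ν ∂ν ∂μ := by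
          refine lintegral_congr fun x => ?_
          rw [lintegral_mul_const _ (hGx x), sq]
      _ = ∫⁻ s, ∫⁻ x, G s x * ∫⁻ s', G s' x ∂ν ∂μ ∂ν := by
          refine lintegral_lintegral_swap (Measurable.aemeasurable ?_)
          exact (hG.comp measurable_swap).mul (hI.comp measurable_fst)
      _ ≤ ∫⁻ s, ∫⁻ s', N s * N s' ∂ν ∂ν := by
          refine lintegral_mono fun s => ?_
          rw [inner_swap s]
          exact lintegral_mono fun s' => cauchy_schwarz s s'
      _ = (∫⁻ s, N s ∂ν) ^ 2 := by
          simp_rw [lintegral_const_mul _ hNm]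
          rw [lintegral_mul_const _ hNm, sq]
  calc _ ≤ ((∫⁻ s, N s ∂ν) ^ 2) ^ ((1 : ℝ) / 2) := ENNReal.rpow_le_rpow key (by norm_num)
    _ = ∫⁻ s, N s ∂ν := by
      rw [← ENNReal.rpow_natCast, ← ENNReal.rpow_mul]
      norm_num

theorem exists_one_add_rpow_mul_exp_neg_le {a c p : ℝ} (ha : 0 ≤ a) (hc : 0 < c) (hp : 1 ≤ p) :
    ∃ C : ℝ, 1 ≤ C ∧ ∀ x : ℝ, 0 ≤ x → (1 + x) ^ a * Real.exp (-(c * x ^ p)) ≤ C := by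
  refine ⟨max 1 (((a + 1) / c) ^ (a + 1) * Real.exp (2 * c)), le_max_left _ _, fun x hx => ?_⟩
  refine le_trans ?_ (le_max_right _ _)
  have hxp : x - 1 ≤ x ^ p := by
    rcases le_total x 1 with h | h
    · linarith [Real.rpow_nonneg hx p]
    · linarith [Real.self_le_rpow_of_one_le h hp]
  have hpow : (1 + x) ^ a ≤ ((a + 1) / c) ^ (a + 1) * Real.exp (c * (1 + x)) := by
    have h1 : 1 + x ≤ (a + 1) / c * Real.exp (c * (1 + x) / (a + 1)) := by
      have h := Real.add_one_le_exp (c * (1 + x) / (a + 1))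
      calc 1 + x = (a + 1) / c * (c * (1 + x) / (a + 1)) := by field_simp
        _ ≤ _ := by gcongr; linarith
    calc (1 + x) ^ a ≤ (1 + x) ^ (a + 1) :=
          Real.rpow_le_rpow_of_exponent_le (by linarith) (by linarith)
      _ ≤ ((a + 1) / c * Real.exp (c * (1 + x) / (a + 1))) ^ (a + 1) :=
          Real.rpow_le_rpow (by linarith) h1 (by linarith)
      _ = _ := by
          rw [Real.mul_rpow (by positivity) (Real.exp_pos _).le, ← Real.exp_mul,
            div_mul_cancel₀ _ (by linarith : a + 1 ≠ 0)]
  calc (1 + x) ^ a * Real.exp (-(c * x ^ p))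
      ≤ ((a + 1) / c) ^ (a + 1) * Real.exp (c * (1 + x)) * Real.exp (-(c * (x - 1))) := by
        gcongr
    _ = _ := by
        rw [mul_assoc, ← Real.exp_add]
        ring_nf

theorem integral_norm_sub_smul_rpow_ge {E : Type*} [NormedAddCommGroup E] [NormedSpace ℝ E]
    {p : ℝ} (hp : 0 ≤ p) {s t : ℝ} (hst : s ≤ t) (φ ξ : E) :
    (t - s) / 2 * ((t - s) * ‖φ‖ / 4) ^ p ≤ ∫ τ in s..t, ‖ξ - τ • φ‖ ^ p := by
  set f : ℝ → ℝ := fun τ => ‖ξ - τ • φ‖ ^ p with hf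
  have hfc : Continuous f := by
    refine Continuous.rpow_const (by fun_prop) fun _ => Or.inr hp
  set r := (t - s) / 2 with hr
  have hr0 : 0 ≤ r := by linarith
  have hpt : ∀ τ, ((t - s) * ‖φ‖ / 4) ^ p ≤ f τ + f (τ + r) := by
    intro τ
    have hsum : (t - s) * ‖φ‖ / 2 ≤ ‖ξ - τ • φ‖ + ‖ξ - (τ + r) • φ‖ := by
      calc (t - s) * ‖φ‖ / 2 = ‖r • φ‖ := by
            rw [norm_smul, Real.norm_of_nonneg hr0, hr]; ring
        _ = ‖(ξ - τ • φ) - (ξ - (τ + r) • φ)‖ := by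
            congr 1; rw [add_smul]; abel
        _ ≤ _ := norm_sub_le _ _
    have hb : 0 ≤ (t - s) * ‖φ‖ / 4 := by
      have := mul_nonneg (sub_nonneg.2 hst) (norm_nonneg φ); linarith
    have h1 : 0 ≤ f τ := by positivity
    have h2 : 0 ≤ f (τ + r) := by positivity
    rcases le_total ((t - s) * ‖φ‖ / 4) ‖ξ - τ • φ‖ with h | h
    · have := Real.rpow_le_rpow hb h hp
      linarith
    · have : (t - s) * ‖φ‖ / 4 ≤ ‖ξ - (τ + r) • φ‖ := by linarith
      have := Real.rpow_le_rpow hb this hp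
      linarith
  have hfi : ∀ a b, IntervalIntegrable f volume a b := fun a b => hfc.intervalIntegrable a b
  have hsplit : ∫ τ in s..t, f τ = ∫ τ in s..(s + r), (f τ + f (τ + r)) := by
    rw [intervalIntegral.integral_add (g := fun τ => f (τ + r)) (hfi _ _)
        ((hfc.comp (continuous_add_const r)).intervalIntegrable _ _),
      intervalIntegral.integral_comp_add_right f r,
      show s + r + r = t by rw [hr]; ring]
    exact (intervalIntegral.integral_add_adjacent_intervals (hfi _ _) (hfi _ _)).symm
  rw [hsplit]
  calc r * ((t - s) * ‖φ‖ / 4) ^ p = ∫ _ in s..(s + r), ((t - s) * ‖φ‖ / 4) ^ p := by simp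
    _ ≤ _ := intervalIntegral.integral_mono_on (by linarith) intervalIntegrable_const
        ((hfc.add (hfc.comp (continuous_add_const r))).intervalIntegrable _ _)
        fun τ _ => hpt τ

section Kolmogorov

variable {d : ℕ}

theorem Wgt_nonneg (β t : ℝ) (φ ξ : EuclideanSpace ℝ (Fin d)) : 0 ≤ Wgt β t φ ξ :=
  (norm_nonneg _).trans (le_max_left _ _)

theorem measurable_Wgt (β : ℝ) :
    Measurable fun p : ℝ × EuclideanSpace ℝ (Fin d) × EuclideanSpace ℝ (Fin d) =>
      Wgt β p.1 p.2.1 p.2.2 := by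
  unfold Wgt
  fun_prop

theorem Wgt_le_add (β s t : ℝ) (φ ξ : EuclideanSpace ℝ (Fin d)) :
    Wgt β t φ ξ ≤ Wgt β s φ ξ + |t - s| * ‖φ‖ := by
  have h0 : 0 ≤ |t - s| * ‖φ‖ := by positivity
  refine max_le ?_ ?_
  · calc ‖ξ - t • φ‖ = ‖(ξ - s • φ) - (t - s) • φ‖ := by congr 1; rw [sub_smul]; abel
      _ ≤ ‖ξ - s • φ‖ + ‖(t - s) • φ‖ := norm_sub_le _ _
      _ ≤ _ := by
          rw [norm_smul, Real.norm_eq_abs]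
          gcongr
          exact le_max_left _ _
  · exact (le_max_right _ _).trans (le_add_of_nonneg_right h0)

theorem Wgt_le_one_add_mul {β : ℝ} (hβ : 0 < β) (s t : ℝ) (φ ξ : EuclideanSpace ℝ (Fin d)) :
    Wgt β t φ ξ
      ≤ (1 + |t - s| * (‖φ‖ ^ (1 / (1 + 2 * β))) ^ (2 * β)) * Wgt β s φ ξ := by
  set m := ‖φ‖ ^ (1 / (1 + 2 * β)) with hm
  have hm0 : 0 ≤ m := by positivity
  have hφ : ‖φ‖ = m ^ (2 * β) * m := by
    rw [← Real.rpow_add_one' hm0 (by positivity), hm, ← Real.rpow_mul (norm_nonneg _),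
      add_comm (2 * β), one_div_mul_cancel (by positivity), Real.rpow_one]
  have hmW : m ≤ Wgt β s φ ξ := le_max_right _ _
  calc Wgt β t φ ξ ≤ Wgt β s φ ξ + |t - s| * ‖φ‖ := Wgt_le_add β s t φ ξ
    _ = Wgt β s φ ξ + |t - s| * m ^ (2 * β) * m := by rw [mul_assoc, ← hφ]
    _ ≤ Wgt β s φ ξ + |t - s| * m ^ (2 * β) * Wgt β s φ ξ := by gcongr
    _ = _ := by ring

theorem Wgt_rpow_le {β : ℝ} (hβ : 0 < β) (α s t : ℝ) (φ ξ : EuclideanSpace ℝ (Fin d)) :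
    Wgt β t φ ξ ^ α
      ≤ (1 + |t - s| * (‖φ‖ ^ (1 / (1 + 2 * β))) ^ (2 * β)) ^ |α| * Wgt β s φ ξ ^ α := by
  set y := 1 + |t - s| * (‖φ‖ ^ (1 / (1 + 2 * β))) ^ (2 * β) with hy
  have hy0 : 0 < y := by positivity
  have hts : Wgt β t φ ξ ≤ y * Wgt β s φ ξ := Wgt_le_one_add_mul hβ s t φ ξ
  have hst : Wgt β s φ ξ ≤ y * Wgt β t φ ξ := by
    have := Wgt_le_one_add_mul hβ t s φ ξ
    rwa [abs_sub_comm] at this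
  have hs0 := Wgt_nonneg β s φ ξ
  have ht0 := Wgt_nonneg β t φ ξ
  rcases le_or_gt 0 α with hα | hα
  · rw [abs_of_nonneg hα, ← Real.mul_rpow hy0.le hs0]
    exact Real.rpow_le_rpow ht0 hts hα
  · rcases hs0.eq_or_lt with h | h
    · have ht : Wgt β t φ ξ = 0 := le_antisymm (by simpa [← h] using hts) ht0
      rw [ht, ← h, Real.zero_rpow hα.ne, mul_zero]
    · have := Real.rpow_le_rpow_of_nonpos h hst hα.le
      rw [Real.mul_rpow hy0.le ht0] at this
      calc Wgt β t φ ξ ^ α = y ^ |α| * (y ^ α * Wgt β t φ ξ ^ α) := by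
            rw [← mul_assoc, ← Real.rpow_add hy0, abs_of_neg hα]; simp
        _ ≤ _ := by gcongr

theorem Kker_le {β : ℝ} (hβ : 0 < β) {s t : ℝ} (hst : s ≤ t)
    (φ ξ : EuclideanSpace ℝ (Fin d)) :
    Kker β t s φ ξ ≤ Real.exp (-((1 / 2 * (1 / 4) ^ (2 * β)) *
      (|t - s| * (‖φ‖ ^ (1 / (1 + 2 * β))) ^ (2 * β)) ^ (1 + 2 * β))) := by
  refine Real.exp_le_exp.2 (neg_le_neg ?_)
  refine le_trans (le_of_eq ?_)
    (integral_norm_sub_smul_rpow_ge (by positivity : 0 ≤ 2 * β) hst φ ξ)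
  have hδ : 0 ≤ t - s := sub_nonneg.2 hst
  have hφ : ((‖φ‖ ^ (1 / (1 + 2 * β))) ^ (2 * β)) ^ (1 + 2 * β) = ‖φ‖ ^ (2 * β) := by
    rw [← Real.rpow_mul (norm_nonneg _), ← Real.rpow_mul (norm_nonneg _)]
    congr 1
    field_simp
  rw [abs_of_nonneg hδ, Real.mul_rpow hδ (by positivity), hφ,
    div_eq_mul_one_div ((t - s) * ‖φ‖) 4, Real.mul_rpow (by positivity) (by norm_num), Real.mul_rpow hδ (norm_nonneg _),
    Real.rpow_one_add' hδ (by positivity)]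
  ring

theorem exists_Wgt_rpow_mul_Kker_le {β : ℝ} (hβ : 0 < β) (α : ℝ) (d : ℕ) :
    ∃ C : ℝ, 0 ≤ C ∧ ∀ (s t : ℝ) (φ ξ : EuclideanSpace ℝ (Fin d)), s ≤ t →
      Wgt β t φ ξ ^ α * Kker β t s φ ξ ≤ C * Wgt β s φ ξ ^ α := by
  obtain ⟨C, hC1, hC⟩ := exists_one_add_rpow_mul_exp_neg_le (abs_nonneg α)
    (by positivity : 0 < 1 / 2 * (1 / 4 : ℝ) ^ (2 * β)) (by linarith : 1 ≤ 1 + 2 * β)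
  refine ⟨C, by linarith, fun s t φ ξ hst => ?_⟩
  have hs0 := Real.rpow_nonneg (Wgt_nonneg β s φ ξ) α
  set x := |t - s| * (‖φ‖ ^ (1 / (1 + 2 * β))) ^ (2 * β) with hx
  have hx0 : 0 ≤ x := by positivity
  calc Wgt β t φ ξ ^ α * Kker β t s φ ξ
      ≤ ((1 + x) ^ |α| * Wgt β s φ ξ ^ α) *
          Real.exp (-((1 / 2 * (1 / 4) ^ (2 * β)) * x ^ (1 + 2 * β))) :=
        mul_le_mul (Wgt_rpow_le hβ α s t φ ξ) (Kker_le hβ hst φ ξ) (Real.exp_pos _).le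
          (by positivity)
    _ = ((1 + x) ^ |α| * Real.exp (-((1 / 2 * (1 / 4) ^ (2 * β)) * x ^ (1 + 2 * β)))) *
          Wgt β s φ ξ ^ α := by ring
    _ ≤ C * Wgt β s φ ξ ^ α := by gcongr; exact hC x hx0

theorem ofReal_Wgt_rpow_two_mul_sub (β γ t : ℝ) (φ ξ : EuclideanSpace ℝ (Fin d)) :
    ENNReal.ofReal (Wgt β t φ ξ ^ (2 * γ - 2 * β))
      = ENNReal.ofReal (Wgt β t φ ξ ^ (γ - β)) ^ 2 := by
  have hW := Wgt_nonneg β t φ ξ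
  rw [← ENNReal.ofReal_pow (by positivity), ← Real.rpow_mul_natCast hW]
  congr 2
  push_cast
  ring

end Kolmogorov

/-- Proof of Proposition 2.10, fourth mapping property (the `L∞` part):
`W^{γ-β} T : L¹_t L²_{φ,ξ}(W^{2γ-2β}) → L^∞_t L²_{φ,ξ}` pointwise bound, with a constant
depending only on `β`, `γ` and `d`. -/
theorem duhamel_L1L2_to_LinftyL2 (β γ : ℝ) (hβ : 0 < β) (d : ℕ) (hd : 1 ≤ d) :
    ∃ C : ℝ≥0∞, C ≠ ⊤ ∧
      ∀ h : ℝ × EuclideanSpace ℝ (Fin d) × EuclideanSpace ℝ (Fin d) → ℝ≥0∞,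
        Measurable h →
          ∀ t : ℝ,
            (∫⁻ φ : EuclideanSpace ℝ (Fin d), ∫⁻ ξ : EuclideanSpace ℝ (Fin d),
                ENNReal.ofReal (Wgt β t φ ξ ^ (2 * γ - 2 * β)) *
                  (∫⁻ s in Set.Iic t,
                    ENNReal.ofReal (Kker β t s φ ξ) * h (s, φ, ξ)) ^ 2) ^ ((1 : ℝ) / 2)
              ≤ C * ∫⁻ s : ℝ,
                  (∫⁻ φ : EuclideanSpace ℝ (Fin d), ∫⁻ ξ : EuclideanSpace ℝ (Fin d),
                    ENNReal.ofReal (Wgt β s φ ξ ^ (2 * γ - 2 * β)) *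
                      h (s, φ, ξ) ^ 2) ^ ((1 : ℝ) / 2) := by
  obtain ⟨C, hC0, hC⟩ := exists_Wgt_rpow_mul_Kker_le hβ (γ - β) d
  refine ⟨ENNReal.ofReal C, ENNReal.ofReal_ne_top, fun h hh t => ?_⟩
  obtain ⟨G, hGdef⟩ : ∃ G : ℝ → EuclideanSpace ℝ (Fin d) × EuclideanSpace ℝ (Fin d) → ℝ≥0∞,
      G = fun s x => ENNReal.ofReal (Wgt β s x.1 x.2 ^ (γ - β)) * h (s, x) := ⟨_, rfl⟩
  have hG : Measurable (Function.uncurry G) := by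
    rw [hGdef]
    exact ((measurable_Wgt β).pow_const (γ - β)).ennreal_ofReal.mul hh
  have hGs : ∀ s, Measurable (G s) := fun s => hG.comp measurable_prodMk_left
  have hpt : ∀ φ ξ : EuclideanSpace ℝ (Fin d),
      ENNReal.ofReal (Wgt β t φ ξ ^ (2 * γ - 2 * β)) *
          (∫⁻ s in Set.Iic t, ENNReal.ofReal (Kker β t s φ ξ) * h (s, φ, ξ)) ^ 2
        ≤ ENNReal.ofReal C ^ 2 * (∫⁻ s in Set.Iic t, G s (φ, ξ)) ^ 2 := by
    intro φ ξ
    rw [ofReal_Wgt_rpow_two_mul_sub, ← mul_pow, ← mul_pow,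
      ← lintegral_const_mul' _ _ ENNReal.ofReal_ne_top,
      ← lintegral_const_mul' _ _ ENNReal.ofReal_ne_top]
    gcongr ?_ ^ 2
    refine setLIntegral_mono' measurableSet_Iic fun s hs => ?_
    have hWt := Real.rpow_nonneg (Wgt_nonneg β t φ ξ) (γ - β)
    rw [hGdef, ← mul_assoc, ← mul_assoc, ← ENNReal.ofReal_mul hWt, ← ENNReal.ofReal_mul hC0]
    exact mul_le_mul_left (ENNReal.ofReal_le_ofReal (hC s t φ ξ hs)) _
  have hprod : ∀ s, ∫⁻ φ : EuclideanSpace ℝ (Fin d), ∫⁻ ξ : EuclideanSpace ℝ (Fin d),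
      ENNReal.ofReal (Wgt β s φ ξ ^ (2 * γ - 2 * β)) * h (s, φ, ξ) ^ 2
        = ∫⁻ x, G s x ^ 2 ∂(volume.prod volume) := by
    intro s
    rw [lintegral_prod _ ((hGs s).pow_const 2).aemeasurable]
    simp_rw [hGdef, mul_pow, ofReal_Wgt_rpow_two_mul_sub]
  have hI : Measurable fun x => ∫⁻ s in Set.Iic t, G s x := hG.lintegral_prod_left
  simp_rw [hprod]
  calc _ ≤ (∫⁻ φ : EuclideanSpace ℝ (Fin d), ∫⁻ ξ : EuclideanSpace ℝ (Fin d),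
        ENNReal.ofReal C ^ 2 * (∫⁻ s in Set.Iic t, G s (φ, ξ)) ^ 2) ^ ((1 : ℝ) / 2) := by
        refine ENNReal.rpow_le_rpow ?_ (by norm_num)
        exact lintegral_mono fun φ => lintegral_mono fun ξ => hpt φ ξ
    _ = (ENNReal.ofReal C ^ 2 * ∫⁻ x, (∫⁻ s in Set.Iic t, G s x) ^ 2
          ∂(volume.prod volume)) ^ ((1 : ℝ) / 2) := by
        rw [← lintegral_const_mul _ (hI.pow_const 2),
          lintegral_prod _ ((hI.pow_const 2).const_mul _).aemeasurable]
    _ = ENNReal.ofReal C * (∫⁻ x, (∫⁻ s in Set.Iic t, G s x) ^ 2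
          ∂(volume.prod volume)) ^ ((1 : ℝ) / 2) := by
        rw [ENNReal.mul_rpow_of_nonneg _ _ (by norm_num), ← ENNReal.rpow_natCast,
          ← ENNReal.rpow_mul]
        norm_num
    _ ≤ ENNReal.ofReal C * ∫⁻ s in Set.Iic t,
          (∫⁻ x, G s x ^ 2 ∂(volume.prod volume)) ^ ((1 : ℝ) / 2) := by
        gcongr
        exact lintegral_sq_lintegral_rpow_half_le _ _ hG
    _ ≤ _ := by
        gcongr
        exact Measure.restrict_le_self
end

section
/- Let β > 0, γ ∈ ℝ and d ≥ 1. For every φ, ξ ∈ ℝ^d with (φ,ξ) ≠ (0,0), the Lebesgue integral ∫_ℝ |ξ − tφ|^{2γ} · exp(−2·∫_0^t |ξ − τφ|^{2β} dτ) dt is infinite (the exponent is interpreted with the signed convention ∫_0^t = −∫_t^0 for t < 0, so the integrand grows as t → −∞). -/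
open MeasureTheory Real
open scoped ENNReal

/-- A function bounded below by a positive constant near `-∞` has infinite integral. -/
theorem lintegral_ofReal_eq_top_of_eventually_atBot_le {g : ℝ → ℝ} {δ : ℝ} (hδ : 0 < δ)
    (h : ∀ᶠ t in Filter.atBot, δ ≤ g t) : ∫⁻ t, ENNReal.ofReal (g t) = ⊤ := by
  obtain ⟨T, hT⟩ := Filter.eventually_atBot.1 h
  refine top_le_iff.1 ?_
  calc (⊤ : ℝ≥0∞) = ∫⁻ _ in Set.Iic T, ENNReal.ofReal δ := by
        simp [ENNReal.mul_top, hδ]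
    _ ≤ ∫⁻ t in Set.Iic T, ENNReal.ofReal (g t) :=
        setLIntegral_mono' measurableSet_Iic fun t ht => ENNReal.ofReal_le_ofReal (hT t ht)
    _ ≤ ∫⁻ t, ENNReal.ofReal (g t) := setLIntegral_le_lintegral _ _

theorem tendsto_norm_sub_smul_atBot {E : Type*} [NormedAddCommGroup E] [NormedSpace ℝ E]
    {φ : E} (hφ : φ ≠ 0) (ξ : E) :
    Filter.Tendsto (fun t : ℝ => ‖ξ - t • φ‖) Filter.atBot Filter.atTop := by
  have h : Filter.Tendsto (fun t : ℝ => |t| * ‖φ‖ - ‖ξ‖) Filter.atBot Filter.atTop :=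
    Filter.tendsto_atTop_add_const_right _ _
      (Filter.tendsto_abs_atBot_atTop.atTop_mul_const (norm_pos_iff.2 hφ))
  refine Filter.tendsto_atTop_mono (fun t => ?_) h
  have := norm_sub_norm_le (t • φ) ξ
  rwa [norm_smul, Real.norm_eq_abs, norm_sub_rev] at this

/-- The exponential factor beats any power of `‖ξ - t • φ‖` as `t → -∞`. -/
theorem eventually_one_le_weighted_kernel {E : Type*} [NormedAddCommGroup E] [NormedSpace ℝ E]
    {β : ℝ} (hβ : 0 < β) (γ : ℝ) {φ : E} (hφ : φ ≠ 0) (ξ : E) :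
    ∀ᶠ t : ℝ in Filter.atBot, 1 ≤ ‖ξ - t • φ‖ ^ (2 * γ) *
      Real.exp (-2 * ∫ τ in (0 : ℝ)..t, ‖ξ - τ • φ‖ ^ (2 * β)) := by
  have hlim := tendsto_norm_sub_smul_atBot hφ ξ
  have hcont : Continuous fun τ : ℝ => ‖ξ - τ • φ‖ ^ (2 * β) :=
    Continuous.rpow_const (by fun_prop) fun _ => Or.inr (by positivity)
  have hint (a b : ℝ) := hcont.intervalIntegrable (μ := volume) a b
  have hφ' : 0 < ‖φ‖ := norm_pos_iff.2 hφ
  obtain ⟨T, hT⟩ := Filter.eventually_atBot.1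
    ((hlim.eventually_ge_atTop 1).and (Filter.eventually_le_atBot 0))
  have hlog := hlim.eventually
    ((Real.isLittleO_log_id_atTop.const_mul_left (2 * γ)).bound (inv_pos.2 hφ'))
  filter_upwards [hlog, Filter.eventually_le_atBot T,
    Filter.eventually_le_atBot (2 * T - ‖φ‖⁻¹ * ‖ξ‖)] with t ht htT htB
  obtain ⟨h1, ht0⟩ := hT t htT
  have hT0 := (hT T le_rfl).2
  have hlower : T - t ≤ ∫ τ in t..0, ‖ξ - τ • φ‖ ^ (2 * β) := by
    rw [← intervalIntegral.integral_add_adjacent_intervals (hint t T) (hint T 0)]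
    have hA : ∫ _ in t..T, (1 : ℝ) ≤ ∫ τ in t..T, ‖ξ - τ • φ‖ ^ (2 * β) :=
      intervalIntegral.integral_mono_on htT intervalIntegrable_const (hint t T) fun τ hτ =>
        Real.one_le_rpow (hT τ hτ.2).1 (by positivity)
    have hB : 0 ≤ ∫ τ in T..0, ‖ξ - τ • φ‖ ^ (2 * β) :=
      intervalIntegral.integral_nonneg hT0 fun τ _ => by positivity
    simp only [intervalIntegral.integral_const, smul_eq_mul, mul_one] at hA
    linarith
  have hnorm : ‖φ‖⁻¹ * ‖ξ - t • φ‖ ≤ ‖φ‖⁻¹ * ‖ξ‖ - t := by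
    have := norm_sub_le ξ (t • φ)
    rw [norm_smul, Real.norm_eq_abs, abs_of_nonpos ht0] at this
    calc ‖φ‖⁻¹ * ‖ξ - t • φ‖ ≤ ‖φ‖⁻¹ * (‖ξ‖ + -t * ‖φ‖) := by gcongr
      _ = ‖φ‖⁻¹ * ‖ξ‖ - t := by field_simp; ring
  simp only [id, norm_norm] at ht
  rw [Real.norm_eq_abs] at ht
  have hlog' := neg_le_of_abs_le ht
  rw [Real.rpow_def_of_pos (by linarith), ← Real.exp_add, intervalIntegral.integral_symm]
  refine Real.one_le_exp ?_
  linarith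

/-- The divergence of the weighted Gaussian-type integral used in the uniqueness proof
(Lemma 3.1): for `β > 0`, `γ ∈ ℝ`, and `(φ,ξ) ≠ (0,0)` in `ℝ^d × ℝ^d`,
`∫_ℝ |ξ - tφ|^{2γ} exp(-2 ∫_0^t |ξ - τφ|^{2β} dτ) dt = ∞`. -/
theorem weighted_kernel_integral_infinite (β γ : ℝ) (hβ : 0 < β) :
    ∀ (d : ℕ), 1 ≤ d → ∀ φ ξ : EuclideanSpace ℝ (Fin d), (φ, ξ) ≠ (0, 0) →
      (∫⁻ t : ℝ, ENNReal.ofReal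
          (‖ξ - t • φ‖ ^ (2 * γ) *
            Real.exp (-2 * ∫ τ in (0 : ℝ)..t, ‖ξ - τ • φ‖ ^ (2 * β)))) = ⊤ := by
  intro d _ φ ξ h
  by_cases hφ : φ = 0
  · subst hφ
    have hξ : 0 < ‖ξ‖ := norm_pos_iff.2 fun h0 => h (by rw [h0])
    refine lintegral_ofReal_eq_top_of_eventually_atBot_le (Real.rpow_pos_of_pos hξ (2 * γ)) ?_
    filter_upwards [Filter.eventually_le_atBot 0] with t ht
    simp only [smul_zero, sub_zero, intervalIntegral.integral_const, smul_eq_mul]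
    refine le_mul_of_one_le_right (by positivity) (Real.one_le_exp ?_)
    have := mul_nonpos_of_nonpos_of_nonneg ht (Real.rpow_nonneg hξ.le (2 * β))
    linarith
  · exact lintegral_ofReal_eq_top_of_eventually_atBot_le one_pos
      (eventually_one_le_weighted_kernel hβ γ hφ ξ)
end

section
/- Let β > 0, γ > 0 and d ≥ 1, and fix φ, ξ ∈ ℝ^d with (φ,ξ) ≠ (0,0). Suppose g : ℝ → ℂ is differentiable and satisfies g′(t) = −|ξ − tφ|^{2β} · g(t) for every t ∈ ℝ, and that ∫_ℝ |ξ − tφ|^{2γ} · |g(t)|² dt < ∞. Then g(t) = 0 for every t ∈ ℝ. -/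
open MeasureTheory Real
open scoped ENNReal

/-- A solution of `g' = -a g` with `a ≥ 0` has nonincreasing squared modulus. -/
theorem antitone_norm_sq_of_deriv_eq_neg_mul {a : ℝ → ℝ} (ha : ∀ t, 0 ≤ a t) {g : ℝ → ℂ}
    (hg : Differentiable ℝ g) (hODE : ∀ t : ℝ, deriv g t = -(↑(a t) : ℂ) * g t) :
    Antitone fun t ↦ ‖g t‖ ^ 2 := by
  have hd (t : ℝ) := (hg t).hasDerivAt.norm_sq
  refine antitone_of_deriv_nonpos (fun t ↦ (hd t).differentiableAt) fun t ↦ ?_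
  have h : deriv g t = (-a t) • g t := by simp [hODE]
  rw [(hd t).deriv, h, inner_smul_right, real_inner_self_eq_norm_sq]
  nlinarith [mul_nonneg (ha t) (sq_nonneg ‖g t‖)]

/-- An affine path other than the constant path `0` stays away from the origin near `-∞`. -/
theorem exists_pos_le_norm_sub_smul {E : Type*} [NormedAddCommGroup E] [NormedSpace ℝ E]
    {φ ξ : E} (h : (φ, ξ) ≠ (0, 0)) :
    ∃ c > 0, ∃ T : ℝ, ∀ t ≤ T, c ≤ ‖ξ - t • φ‖ := by
  by_cases hφ : φ = 0
  · subst hφ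
    have hξ : ξ ≠ 0 := fun h' ↦ h (by rw [h'])
    exact ⟨‖ξ‖, norm_pos_iff.2 hξ, 0, fun t _ ↦ by simp⟩
  · have hp : 0 < ‖φ‖ := norm_pos_iff.2 hφ
    refine ⟨1, one_pos, -((1 + ‖ξ‖) / ‖φ‖), fun t ht ↦ ?_⟩
    have h1 : 1 + ‖ξ‖ ≤ -t * ‖φ‖ := (div_le_iff₀ hp).1 (by linarith)
    have h2 : ‖t • φ‖ - ‖ξ‖ ≤ ‖ξ - t • φ‖ := by
      rw [norm_sub_rev]
      exact norm_sub_norm_le _ _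
    rw [norm_smul, Real.norm_eq_abs] at h2
    nlinarith [mul_le_mul_of_nonneg_right (neg_le_abs t) hp.le]

/-- Fiberwise uniqueness (Lemma 3.1 after Fourier transform): if `β > 0`, `γ > 0`,
`(φ,ξ) ≠ (0,0)`, and `g : ℝ → ℂ` is differentiable with
`g'(t) = -|ξ - tφ|^{2β} g(t)` and `∫_ℝ |ξ - tφ|^{2γ} |g(t)|² dt < ∞`, then `g ≡ 0`. -/
theorem fiberwise_uniqueness (β γ : ℝ) (hβ : 0 < β) (hγ : 0 < γ)
    (d : ℕ) (hd : 1 ≤ d) (φ ξ : EuclideanSpace ℝ (Fin d)) (hφξ : (φ, ξ) ≠ (0, 0))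
    (g : ℝ → ℂ) (hg : Differentiable ℝ g)
    (hODE : ∀ t : ℝ, deriv g t = -(↑(‖ξ - t • φ‖ ^ (2 * β)) : ℂ) * g t)
    (hint : (∫⁻ t : ℝ, ENNReal.ofReal (‖ξ - t • φ‖ ^ (2 * γ) * ‖g t‖ ^ 2)) ≠ ⊤) :
    ∀ t : ℝ, g t = 0 := by
  intro t₀
  by_contra h₀
  have hanti := antitone_norm_sq_of_deriv_eq_neg_mul
    (a := fun t ↦ ‖ξ - t • φ‖ ^ (2 * β)) (fun t ↦ by positivity) hg hODE
  obtain ⟨c, hc, T, hT⟩ := exists_pos_le_norm_sub_smul hφξ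
  have hpos : 0 < c ^ (2 * γ) * ‖g t₀‖ ^ 2 := by positivity
  refine hint (top_le_iff.1 ?_)
  calc
    ⊤ = ∫⁻ _ in Set.Iic (min T t₀), ENNReal.ofReal (c ^ (2 * γ) * ‖g t₀‖ ^ 2) := by
      rw [setLIntegral_const, Real.volume_Iic, ENNReal.mul_top (ENNReal.ofReal_pos.2 hpos).ne']
    _ ≤ ∫⁻ t in Set.Iic (min T t₀),
        ENNReal.ofReal (‖ξ - t • φ‖ ^ (2 * γ) * ‖g t‖ ^ 2) := by
      refine setLIntegral_mono' measurableSet_Iic fun t ht ↦ ENNReal.ofReal_le_ofReal ?_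
      obtain ⟨htT, ht₀⟩ := le_min_iff.1 (Set.mem_Iic.1 ht)
      exact mul_le_mul (Real.rpow_le_rpow hc.le (hT t htT) (by positivity)) (hanti ht₀)
        (by positivity) (by positivity)
    _ ≤ _ := setLIntegral_le_lintegral _ _
end

section
/- Let F be a complex Hilbert space and let H be a complex inner product space together with a linear map j : H → F and a constant c₁ > 0 such that ‖j(h)‖_F ≤ c₁·‖h‖_H for all h ∈ H. Let E : F × H → ℂ be a map that is linear in its first argument and conjugate-linear in its second argument, and assume: (H1) for every h ∈ H, the linear functional f ↦ E(f,h) is continuous on F; (H2) there exists α > 0 such that Re E(j(h), h) ≥ α·‖h‖_H² for all h ∈ H. Then for every conjugate-linear functional L : H → ℂ that is bounded (i.e., there exists M with |L(h)| ≤ M·‖h‖_H for all h ∈ H), there exists f ∈ F such that E(f,h) = L(h) for all h ∈ H. -/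
open MeasureTheory Complex

/-- A linear functional dominated by `‖T ·‖` factors through `T` as a continuous functional. -/
theorem LinearMap.exists_strongDual_comp_eq_of_norm_le
    {𝕜 V W : Type*} [RCLike 𝕜] [AddCommGroup V] [Module 𝕜 V]
    [NormedAddCommGroup W] [NormedSpace 𝕜 W]
    (T : V →ₗ[𝕜] W) (l : V →ₗ[𝕜] 𝕜) (C : ℝ) (hC : ∀ v, ‖l v‖ ≤ C * ‖T v‖) :
    ∃ g : StrongDual 𝕜 W, ∀ v, g (T v) = l v := by
  obtain ⟨s, hs⟩ := T.rangeRestrict.exists_rightInverse_of_surjective T.range_rangeRestrict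
  have hTs (y : T.range) : T (s y) = y := congrArg Subtype.val (LinearMap.congr_fun hs y)
  let φ : StrongDual 𝕜 T.range := (l ∘ₗ s).mkContinuous C fun y => by
    simpa [hTs] using hC (s y)
  obtain ⟨g, hg, -⟩ := exists_extension_norm_eq T.range φ
  refine ⟨g, fun v => (hg (T.rangeRestrict v)).trans ?_⟩
  have h := hC (s (T.rangeRestrict v) - v)
  rw [map_sub T, hTs, LinearMap.codRestrict_apply, sub_self, norm_zero, mul_zero,
    norm_le_zero_iff, map_sub, sub_eq_zero] at h
  exact h

/-- Riesz representation of a form that is continuous in its first variable. -/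
theorem LinearMap.exists_inner_eq_of_continuous
    {𝕜 V W : Type*} [RCLike 𝕜] [AddCommGroup V] [Module 𝕜 V]
    [NormedAddCommGroup W] [InnerProductSpace 𝕜 W] [CompleteSpace W]
    (E : W →ₗ[𝕜] V →ₗ⋆[𝕜] 𝕜) (hE : ∀ v, Continuous fun w => E w v) :
    ∃ T : V →ₗ[𝕜] W, ∀ w v, inner 𝕜 (T v) w = E w v := by
  have hT (v : V) (w : W) :
      inner 𝕜 ((InnerProductSpace.toDual 𝕜 W).symm ⟨E.flip v, hE v⟩) w = E w v :=
    InnerProductSpace.toDual_symm_apply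
  refine ⟨{ toFun := fun v => (InnerProductSpace.toDual 𝕜 W).symm ⟨E.flip v, hE v⟩
            map_add' := fun u v => ext_inner_right 𝕜 fun w => ?_
            map_smul' := fun c v => ext_inner_right 𝕜 fun w => ?_ }, fun w v => hT v w⟩
  · rw [inner_add_left, hT, hT, hT, map_add]
  · rw [RingHom.id_apply, inner_smul_left, hT, hT, map_smulₛₗ, smul_eq_mul]

/-- Lions' variational existence theorem (Theorem 4.1): let `F` be a complex Hilbert
space, `H` a complex inner product space with a linear map `j : H → F` satisfying
`‖j h‖ ≤ c₁ ‖h‖`, and `E : F × H → ℂ` a sesquilinear form (linear in the first variable,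
conjugate-linear in the second) such that (H1) for each `h` the functional `f ↦ E f h` is
continuous on `F`, and (H2) `Re E(j h, h) ≥ α ‖h‖²` for some `α > 0`. Then every bounded
conjugate-linear functional `L` on `H` admits `f ∈ F` with `E f h = L h` for all `h`. -/
theorem lions_existence
    {F H : Type*} [NormedAddCommGroup F] [InnerProductSpace ℂ F] [CompleteSpace F]
    [NormedAddCommGroup H] [InnerProductSpace ℂ H]
    (j : H →ₗ[ℂ] F) (c₁ : ℝ) (hc₁ : 0 < c₁) (hj : ∀ h : H, ‖j h‖ ≤ c₁ * ‖h‖)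
    (E : F →ₗ[ℂ] H →ₗ⋆[ℂ] ℂ)
    (H1 : ∀ h : H, Continuous fun f : F => E f h)
    (α : ℝ) (hα : 0 < α)
    (H2 : ∀ h : H, α * ‖h‖ ^ 2 ≤ (E (j h) h).re)
    (L : H →ₗ⋆[ℂ] ℂ) (M : ℝ) (hL : ∀ h : H, ‖L h‖ ≤ M * ‖h‖) :
    ∃ f : F, ∀ h : H, E f h = L h := by
  obtain ⟨T, hT⟩ := E.exists_inner_eq_of_continuous H1
  have hlower (h : H) : α * ‖h‖ ≤ c₁ * ‖T h‖ := by
    rcases (norm_nonneg h).eq_or_lt with h0 | hpos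
    · rw [← h0, mul_zero]
      positivity
    refine le_of_mul_le_mul_right ?_ hpos
    calc α * ‖h‖ * ‖h‖ = α * ‖h‖ ^ 2 := by ring
      _ ≤ (E (j h) h).re := H2 h
      _ ≤ ‖inner ℂ (T h) (j h)‖ := hT (j h) h ▸ Complex.re_le_norm _
      _ ≤ ‖T h‖ * ‖j h‖ := norm_inner_le_norm _ _
      _ ≤ ‖T h‖ * (c₁ * ‖h‖) := by gcongr; exact hj h
      _ = c₁ * ‖T h‖ * ‖h‖ := by ring
  let l : H →ₗ[ℂ] ℂ :=
    { toFun := fun h => starRingEnd ℂ (L h)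
      map_add' := fun x y => by simp
      map_smul' := fun c x => by simp }
  obtain ⟨g, hg⟩ := T.exists_strongDual_comp_eq_of_norm_le l (|M| * (c₁ / α)) fun h => by
    calc ‖l h‖ = ‖L h‖ := RCLike.norm_conj _
      _ ≤ M * ‖h‖ := hL h
      _ ≤ |M| * ‖h‖ := by gcongr; exact le_abs_self M
      _ ≤ |M| * (c₁ * ‖T h‖ / α) := by
        gcongr
        rw [le_div_iff₀ hα, mul_comm]
        exact hlower h
      _ = |M| * (c₁ / α) * ‖T h‖ := by ring
  refine ⟨(InnerProductSpace.toDual ℂ F).symm g, fun h => ?_⟩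
  rw [← hT, ← inner_conj_symm, InnerProductSpace.toDual_symm_apply, hg]
  exact Complex.conj_conj (L h)
end
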